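/- Let 0 < ℓ < u, p > 1 and 0 ≤ q₁ < q₂ ≤ p−1, and set k := ℓ/u. Then (vol(invbreve S_p^{q₁}(ℓ,u)) − vol(invbreve S_p^{q₂}(ℓ,u))) / vol(invbreve S_p^{q₁}(ℓ,u)) = 6·(q₂−q₁)·((1−k^{p+1})/((1−k)·(1+k^p))) / ((p−q₂+2)·(p²+3p−q₁·(p+1)−1) − 3·(p−q₂+2)·((1+k)·(1−k^p))/((1−k)·(1+k^p))), and this ratio is strictly greater than 6·(q₂−q₁) / ((p−q₂+2)·(p²+3p−q₁·(p+1)−4)). -/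

import Mathlib

open MeasureTheory

/-- `invbreve S_p^q(ℓ,u)`; real powers (`Real.rpow`, with `0^0 = 1`). -/
noncomputable def invSpq (ℓ u p q : ℝ) : Set (ℝ × ℝ × ℝ) :=
  {s | 0 ≤ s.2.1 ∧ s.1 ^ p ≤ s.2.1 * s.2.2 ^ q ∧
       s.2.1 ≤ (ℓ ^ p - (u ^ p - ℓ ^ p) / (u - ℓ) * ℓ) * s.2.2
                 + (u ^ p - ℓ ^ p) / (u - ℓ) * s.1 ∧
       ℓ * s.2.2 ≤ s.1 ∧ s.1 ≤ u * s.2.2 ∧ 0 ≤ s.2.2 ∧ s.2.2 ≤ 1}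

lemma measurableSet_invSpq (ℓ u p q : ℝ) : MeasurableSet (invSpq ℓ u p q) := by
  simp only [invSpq, Set.ofPred_and]
  refine .inter (measurableSet_le ?_ ?_) (.inter (measurableSet_le ?_ ?_)
    (.inter (measurableSet_le ?_ ?_) (.inter (measurableSet_le ?_ ?_)
      (.inter (measurableSet_le ?_ ?_) (.inter (measurableSet_le ?_ ?_)
        (measurableSet_le ?_ ?_)))))) <;> fun_prop

/-- Tonelli: slice in the second coordinate, then integrate over the first and third ones. -/
lemma volume_eq_lintegral_lintegral_slice {S : Set (ℝ × ℝ × ℝ)} (hS : MeasurableSet S) :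
    volume S = ∫⁻ z, ∫⁻ x, volume {y : ℝ | (x, y, z) ∈ S} := by
  have hmeas : Measurable fun w : ℝ × ℝ => volume {y : ℝ | (w.1, y, w.2) ∈ S} := by
    have hT : MeasurableSet ((fun v : (ℝ × ℝ) × ℝ => (v.1.1, v.2, v.1.2)) ⁻¹' S) :=
      hS.preimage (by fun_prop)
    exact measurable_measure_prodMk_left hT
  rw [lintegral_lintegral_swap (f := fun z x => volume {y : ℝ | (x, y, z) ∈ S})
    (hmeas.comp measurable_swap).aemeasurable,
    Measure.volume_eq_prod, Measure.prod_apply hS]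
  refine lintegral_congr fun x => ?_
  rw [Measure.volume_eq_prod, Measure.prod_apply_symm (hS.preimage (by fun_prop))]
  rfl

lemma slice_invSpq {ℓ u p q x z : ℝ} (hℓ : 0 < ℓ) (hz : z ∈ Set.Ioc (0 : ℝ) 1) :
    {y : ℝ | (x, y, z) ∈ invSpq ℓ u p q} =
      {y : ℝ | x ∈ Set.Icc (ℓ * z) (u * z) ∧ y ∈ Set.Icc (x ^ p / z ^ q)
        ((ℓ ^ p - (u ^ p - ℓ ^ p) / (u - ℓ) * ℓ) * z + (u ^ p - ℓ ^ p) / (u - ℓ) * x)} := by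
  have hzq : 0 < z ^ q := Real.rpow_pos_of_pos hz.1 q
  ext y
  simp only [invSpq, Set.mem_ofPred_eq, Set.mem_Icc, div_le_iff₀ hzq]
  constructor
  · rintro ⟨-, h1, h2, h3, h4, -⟩
    exact ⟨⟨h3, h4⟩, h1, h2⟩
  · rintro ⟨⟨h3, h4⟩, h1, h2⟩
    have hx : 0 ≤ x := (mul_nonneg hℓ.le hz.1.le).trans h3
    exact ⟨nonneg_of_mul_nonneg_left ((Real.rpow_nonneg hx p).trans h1) hzq,
      h1, h2, h3, h4, hz.1.le, hz.2⟩

lemma slice_invSpq_eq_empty {ℓ u p q x z : ℝ} (hz : z ∉ Set.Icc (0 : ℝ) 1) :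
    {y : ℝ | (x, y, z) ∈ invSpq ℓ u p q} = ∅ := by
  ext y
  simp only [invSpq, Set.mem_ofPred_eq, Set.mem_empty_iff_false, iff_false]
  rintro ⟨-, -, -, -, -, h0, h1⟩
  exact hz ⟨h0, h1⟩

/-- The power function lies below its chord on `[ℓ, u]`. -/
lemma rpow_le_chord {ℓ u p t : ℝ} (hℓ : 0 < ℓ) (hℓu : ℓ < u) (hp : 1 ≤ p)
    (ht : t ∈ Set.Icc ℓ u) :
    t ^ p ≤ ℓ ^ p - (u ^ p - ℓ ^ p) / (u - ℓ) * ℓ + (u ^ p - ℓ ^ p) / (u - ℓ) * t := by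
  have hd : 0 < u - ℓ := sub_pos.2 hℓu
  have h := (convexOn_rpow hp).2 (Set.mem_Ici.2 hℓ.le) (Set.mem_Ici.2 (hℓ.trans hℓu).le)
    (div_nonneg (sub_nonneg.2 ht.2) hd.le) (div_nonneg (sub_nonneg.2 ht.1) hd.le)
    (by field_simp; ring)
  have e : (u - t) / (u - ℓ) * ℓ + (t - ℓ) / (u - ℓ) * u = t := by field_simp; ring
  simp only [smul_eq_mul] at h
  rw [e] at h
  refine h.trans_eq ?_
  field_simp
  ring

lemma rpow_div_rpow_le_chord {ℓ u p q x z : ℝ} (hℓ : 0 < ℓ) (hℓu : ℓ < u) (hp : 1 ≤ p)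
    (hq : q ≤ p - 1) (hz : z ∈ Set.Ioc (0 : ℝ) 1) (hx : x ∈ Set.Icc (ℓ * z) (u * z)) :
    x ^ p / z ^ q ≤
      (ℓ ^ p - (u ^ p - ℓ ^ p) / (u - ℓ) * ℓ) * z + (u ^ p - ℓ ^ p) / (u - ℓ) * x := by
  obtain ⟨hz0, hz1⟩ := hz
  have ht : x / z ∈ Set.Icc ℓ u := ⟨(le_div_iff₀ hz0).2 hx.1, (div_le_iff₀ hz0).2 hx.2⟩
  have h := rpow_le_chord hℓ hℓu hp ht
  have ht0 : 0 ≤ x / z := hℓ.le.trans ht.1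
  have hxe : x = x / z * z := by field_simp
  have e : x ^ p / z ^ q = (x / z) ^ p * z ^ (p - q) := by
    conv_lhs => rw [hxe]
    rw [Real.mul_rpow ht0 hz0.le, Real.rpow_sub hz0, mul_div_assoc]
  have hzp : z ^ (p - q) ≤ z := by
    simpa using Real.rpow_le_rpow_of_exponent_ge hz0 hz1 (show (1 : ℝ) ≤ p - q by linarith)
  calc x ^ p / z ^ q = (x / z) ^ p * z ^ (p - q) := e
    _ ≤ (x / z) ^ p * z := by gcongr
    _ ≤ (ℓ ^ p - (u ^ p - ℓ ^ p) / (u - ℓ) * ℓ + (u ^ p - ℓ ^ p) / (u - ℓ) * (x / z)) * z := by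
        gcongr
    _ = _ := by field_simp

lemma integral_chord_sub_rpow {ℓ u p q z : ℝ} (hℓ : 0 < ℓ) (hℓu : ℓ < u) (hp : 1 < p)
    (hz0 : 0 < z) :
    ∫ x in (ℓ * z)..(u * z), ((ℓ ^ p - (u ^ p - ℓ ^ p) / (u - ℓ) * ℓ) * z
        + (u ^ p - ℓ ^ p) / (u - ℓ) * x - x ^ p / z ^ q) =
      (u - ℓ) * (ℓ ^ p + u ^ p) / 2 * z ^ (2 : ℕ)
        - (u ^ (p + 1) - ℓ ^ (p + 1)) / (p + 1) * z ^ (p - q + 1) := by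
  have hu : 0 < u := hℓ.trans hℓu
  have hcont : Continuous fun x : ℝ => x ^ p := Real.continuous_rpow_const (by linarith)
  rw [intervalIntegral.integral_sub (Continuous.intervalIntegrable (by fun_prop) _ _)
      ((hcont.div_const _).intervalIntegrable _ _),
    intervalIntegral.integral_add (by simp) (Continuous.intervalIntegrable (by fun_prop) _ _),
    intervalIntegral.integral_const, intervalIntegral.integral_const_mul, integral_id,
    intervalIntegral.integral_div, integral_rpow (Or.inl (by linarith)),
    Real.mul_rpow hu.le hz0.le, Real.mul_rpow hℓ.le hz0.le]
  have e : z ^ (p - q + 1) = z ^ (p + 1) / z ^ q := by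
    rw [← Real.rpow_sub hz0]; ring_nf
  have hd : u - ℓ ≠ 0 := (sub_pos.2 hℓu).ne'
  have hzq : z ^ q ≠ 0 := (Real.rpow_pos_of_pos hz0 q).ne'
  have hp1 : p + 1 ≠ 0 := by linarith
  rw [e, smul_eq_mul]
  field_simp
  ring

lemma slice_area_nonneg {ℓ u p q z : ℝ} (hℓ : 0 < ℓ) (hℓu : ℓ < u) (hp : 1 < p)
    (hq : q ≤ p - 1) (hz : z ∈ Set.Ioc (0 : ℝ) 1) :
    0 ≤ (u - ℓ) * (ℓ ^ p + u ^ p) / 2 * z ^ (2 : ℕ)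
        - (u ^ (p + 1) - ℓ ^ (p + 1)) / (p + 1) * z ^ (p - q + 1) := by
  rw [← integral_chord_sub_rpow hℓ hℓu hp hz.1]
  exact intervalIntegral.integral_nonneg (mul_le_mul_of_nonneg_right hℓu.le hz.1.le)
    fun x hx => sub_nonneg.2 (rpow_div_rpow_le_chord hℓ hℓu hp.le hq hz hx)

lemma lintegral_slice_invSpq {ℓ u p q z : ℝ} (hℓ : 0 < ℓ) (hℓu : ℓ < u) (hp : 1 < p)
    (hq : q ≤ p - 1) (hz : z ∈ Set.Ioc (0 : ℝ) 1) :
    ∫⁻ x, volume {y : ℝ | (x, y, z) ∈ invSpq ℓ u p q} =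
      ENNReal.ofReal ((u - ℓ) * (ℓ ^ p + u ^ p) / 2 * z ^ (2 : ℕ)
        - (u ^ (p + 1) - ℓ ^ (p + 1)) / (p + 1) * z ^ (p - q + 1)) := by
  have hslice : ∀ x, volume {y : ℝ | (x, y, z) ∈ invSpq ℓ u p q} =
      (Set.Icc (ℓ * z) (u * z)).indicator
        (fun x => ENNReal.ofReal ((ℓ ^ p - (u ^ p - ℓ ^ p) / (u - ℓ) * ℓ) * z
          + (u ^ p - ℓ ^ p) / (u - ℓ) * x - x ^ p / z ^ q)) x := by
    intro x
    rw [slice_invSpq hℓ hz]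
    by_cases hx : x ∈ Set.Icc (ℓ * z) (u * z)
    · rw [Set.indicator_of_mem hx, ← Real.volume_Icc]
      simp only [hx, true_and]
      rfl
    · rw [Set.indicator_of_notMem hx]
      simp [hx]
  have hcont : Continuous fun x : ℝ => x ^ p := Real.continuous_rpow_const (by linarith)
  have hcont' : Continuous fun x : ℝ => (ℓ ^ p - (u ^ p - ℓ ^ p) / (u - ℓ) * ℓ) * z
      + (u ^ p - ℓ ^ p) / (u - ℓ) * x - x ^ p / z ^ q :=
    Continuous.sub (by fun_prop) (hcont.div_const _)
  simp_rw [hslice]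
  rw [lintegral_indicator measurableSet_Icc, ← ofReal_integral_eq_lintegral_ofReal
    (hcont'.integrableOn_Icc) ((ae_restrict_iff' measurableSet_Icc).2 (.of_forall fun x hx =>
      sub_nonneg.2 (rpow_div_rpow_le_chord hℓ hℓu hp.le hq hz hx))),
    integral_Icc_eq_integral_Ioc, ← intervalIntegral.integral_of_le
      (mul_le_mul_of_nonneg_right hℓu.le hz.1.le), integral_chord_sub_rpow hℓ hℓu hp hz.1]

lemma volume_invSpq {ℓ u p q : ℝ} (hℓ : 0 < ℓ) (hℓu : ℓ < u) (hp : 1 < p)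
    (hq : q ≤ p - 1) :
    (volume (invSpq ℓ u p q)).toReal =
      (u - ℓ) * (ℓ ^ p + u ^ p) / 6
        - (u ^ (p + 1) - ℓ ^ (p + 1)) / (p + 1) / (p - q + 2) := by
  set a := (u - ℓ) * (ℓ ^ p + u ^ p) / 2 with ha
  set b := (u ^ (p + 1) - ℓ ^ (p + 1)) / (p + 1)
  have hae : ∀ᵐ z : ℝ, ∫⁻ x, volume {y : ℝ | (x, y, z) ∈ invSpq ℓ u p q} =
      (Set.Ioc (0 : ℝ) 1).indicator
        (fun z => ENNReal.ofReal (a * z ^ (2 : ℕ) - b * z ^ (p - q + 1))) z := by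
    filter_upwards [Measure.ae_ne volume (0 : ℝ)] with z hz0
    by_cases hz : z ∈ Set.Ioc (0 : ℝ) 1
    · rw [Set.indicator_of_mem hz, lintegral_slice_invSpq hℓ hℓu hp hq hz]
    · have hz' : z ∉ Set.Icc (0 : ℝ) 1 := fun h => hz ⟨lt_of_le_of_ne h.1 hz0.symm, h.2⟩
      rw [Set.indicator_of_notMem hz]
      simp [slice_invSpq_eq_empty hz']
  have hcont : Continuous fun z : ℝ => z ^ (p - q + 1) :=
    Real.continuous_rpow_const (by linarith)
  have hnonneg : ∀ z ∈ Set.Ioc (0 : ℝ) 1, 0 ≤ a * z ^ (2 : ℕ) - b * z ^ (p - q + 1) :=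
    fun z hz => slice_area_nonneg hℓ hℓu hp hq hz
  rw [volume_eq_lintegral_lintegral_slice (measurableSet_invSpq ℓ u p q), lintegral_congr_ae hae,
    lintegral_indicator measurableSet_Ioc, ← integral_eq_lintegral_of_nonneg_ae
      ((ae_restrict_iff' measurableSet_Ioc).2 (.of_forall hnonneg))
      (Continuous.aestronglyMeasurable (by fun_prop)),
    ← intervalIntegral.integral_of_le zero_le_one,
    intervalIntegral.integral_sub (Continuous.intervalIntegrable (by fun_prop) _ _)
      (Continuous.intervalIntegrable (by fun_prop) _ _),
    intervalIntegral.integral_const_mul, intervalIntegral.integral_const_mul, integral_pow,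
    integral_rpow (Or.inl (by linarith)), Real.zero_rpow (by linarith), Real.one_rpow]
  have h2 : p - q + 2 ≠ 0 := by linarith
  rw [show p - q + 1 + 1 = p - q + 2 by ring, ha]
  norm_num
  field_simp
  ring

theorem invSpq_volume_ratio (ℓ u p q₁ q₂ k : ℝ) (hℓ : 0 < ℓ) (hℓu : ℓ < u)
    (hp : 1 < p) (hq₁ : 0 ≤ q₁) (hq₁₂ : q₁ < q₂) (hq₂ : q₂ ≤ p - 1)
    (hk : k = ℓ / u) :
    ((volume (invSpq ℓ u p q₁)).toReal - (volume (invSpq ℓ u p q₂)).toReal)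
        / (volume (invSpq ℓ u p q₁)).toReal
      = 6 * (q₂ - q₁) * ((1 - k ^ (p + 1)) / ((1 - k) * (1 + k ^ p)))
        / ((p - q₂ + 2) * (p ^ 2 + 3 * p - q₁ * (p + 1) - 1)
            - 3 * (p - q₂ + 2) * ((1 + k) * (1 - k ^ p)) / ((1 - k) * (1 + k ^ p))) ∧
    6 * (q₂ - q₁) / ((p - q₂ + 2) * (p ^ 2 + 3 * p - q₁ * (p + 1) - 4))
      < ((volume (invSpq ℓ u p q₁)).toReal - (volume (invSpq ℓ u p q₂)).toReal)
          / (volume (invSpq ℓ u p q₁)).toReal := by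
  have hu : 0 < u := hℓ.trans hℓu
  have hk0 : 0 < k := hk ▸ div_pos hℓ hu
  have hk1 : k < 1 := hk ▸ (div_lt_one hu).2 hℓu
  have hℓk : ℓ = k * u := by rw [hk]; field_simp
  rw [volume_invSpq hℓ hℓu hp hq₂, volume_invSpq hℓ hℓu hp (hq₁₂.le.trans hq₂)]
  have htrap := slice_area_nonneg (q := 0) hℓ hℓu hp (by linarith) (z := 1) (by simp)
  rw [Real.one_rpow, one_pow, mul_one, mul_one] at htrap
  set U := u ^ p
  set K := k ^ p
  have hUpos : 0 < U := Real.rpow_pos_of_pos hu p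
  have hKpos : 0 < K := Real.rpow_pos_of_pos hk0 p
  have hKk : K < k := by
    simpa using Real.rpow_lt_rpow_of_exponent_gt hk0 hk1 hp
  have hℓp : ℓ ^ p = K * U := by rw [hℓk, Real.mul_rpow hk0.le hu.le]
  have hu1 : u ^ (p + 1) = U * u := by rw [Real.rpow_add_one hu.ne']
  have hk1p : k ^ (p + 1) = K * k := by rw [Real.rpow_add_one hk0.ne']
  have hℓ1 : ℓ ^ (p + 1) = K * U * (k * u) := by
    rw [Real.rpow_add_one hℓ.ne', hℓp, ← hℓk]
  rw [hℓp, hu1, hℓ1, hℓk] at htrap ⊢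
  rw [hk1p]
  clear_value U K
  have hD : 0 < (1 - k) * (1 + K) := mul_pos (by linarith) (by linarith)
  set β := (1 - K * k) / ((1 - k) * (1 + K)) with hβ
  have hβD : β * ((1 - k) * (1 + K)) = 1 - K * k := div_mul_cancel₀ _ hD.ne'
  have hβ1 : 1 < β := by
    rw [hβ, one_lt_div hD]; linarith
  have hp1 : 0 < p + 1 := by linarith
  have hβp : 2 * β ≤ p + 1 := by
    have e : (u - k * u) * (K * U + U) / 2 - (U * u - K * U * (k * u)) / (p + 1)
        = U * u * ((1 - k) * (1 + K)) / (2 * (p + 1)) * (p + 1 - 2 * β) := by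
      rw [show U * u - K * U * (k * u) = U * u * (1 - K * k) by ring, ← hβD]
      field_simp
      ring
    rw [e] at htrap
    exact sub_nonneg.1 (nonneg_of_mul_nonneg_right htrap (by positivity))
  have hr₁ : 3 ≤ p - q₁ + 2 := by linarith
  have hr₂ : 0 < p - q₂ + 2 := by linarith
  have hden : 0 < (p + 1) * (p - q₁ + 2) - 6 * β := by
    nlinarith [mul_pos hp1 (show 0 < p - q₁ - 1 by linarith)]
  have hγ : 3 * (p - q₂ + 2) * ((1 + k) * (1 - K)) / ((1 - k) * (1 + K))
      = (p - q₂ + 2) * (6 * β - 3) := by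
    rw [div_eq_iff hD.ne']
    linear_combination -6 * (p - q₂ + 2) * hβD
  have hA : 0 < (u - k * u) * (K * U + U) / 6 := by
    have : (u - k * u) * (K * U + U) / 6 = U * u * ((1 - k) * (1 + K)) / 6 := by ring
    rw [this]; positivity
  have hB : (U * u - K * U * (k * u)) / (p + 1)
      = (u - k * u) * (K * U + U) / 6 * (6 * β / (p + 1)) := by
    rw [show U * u - K * U * (k * u) = U * u * (1 - K * k) by ring, ← hβD]
    field_simp
    ring
  rw [hB, hγ]
  generalize (u - k * u) * (K * U + U) / 6 = A at hA
  have hden' : (p - q₂ + 2) * (p ^ 2 + 3 * p - q₁ * (p + 1) - 1) - (p - q₂ + 2) * (6 * β - 3)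
      = (p - q₂ + 2) * ((p + 1) * (p - q₁ + 2) - 6 * β) := by ring
  have hden'' : p ^ 2 + 3 * p - q₁ * (p + 1) - 4 = (p + 1) * (p - q₁ + 2) - 6 := by ring
  have hratio : (A - A * (6 * β / (p + 1)) / (p - q₁ + 2)
        - (A - A * (6 * β / (p + 1)) / (p - q₂ + 2)))
      / (A - A * (6 * β / (p + 1)) / (p - q₁ + 2))
      = 6 * (q₂ - q₁) * β / ((p - q₂ + 2) * ((p + 1) * (p - q₁ + 2) - 6 * β)) := by
    have hr₁' : 0 < p - q₁ + 2 := by linarith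
    have hV : A - A * (6 * β / (p + 1)) / (p - q₁ + 2)
        = A * ((p + 1) * (p - q₁ + 2) - 6 * β) / ((p + 1) * (p - q₁ + 2)) := by
      field_simp
    rw [hV]
    field_simp
    ring
  rw [hratio, hden', hden'']
  refine ⟨rfl, ?_⟩
  have hq : 0 < 6 * (q₂ - q₁) := by linarith
  rw [div_lt_div_iff₀ (mul_pos hr₂ (by linarith)) (mul_pos hr₂ hden)]
  have hpos : 0 < 6 * (q₂ - q₁) * (p - q₂ + 2) * (β - 1) * ((p + 1) * (p - q₁ + 2)) :=
    mul_pos (mul_pos (mul_pos hq hr₂) (by linarith)) (mul_pos hp1 (by linarith))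
  linear_combination hpos
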